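/- For every integer l ≥ 1 the A_1 Macdonald polynomials satisfy the Pieri rule (x + x^{−1}) · P_l(x) = P_{l+1}(x) + [(1 − q^{2l})(1 − q^{2(l−1)} t^4)] / [(1 − q^{2l} t^2)(1 − q^{2(l−1)} t^2)] · P_{l−1}(x) in ℚ(q,t)[x, x^{−1}]. -/

import Mathlib

/-!
STATEMENT 5: For every integer `l ≥ 1` the `A₁` Macdonald polynomials satisfy the Pieri rule
`(x + x⁻¹)·P_l(x) = P_{l+1}(x) + [(1 − q^{2l})(1 − q^{2(l−1)}t⁴)] /
  [(1 − q^{2l}t²)(1 − q^{2(l−1)}t²)] · P_{l−1}(x)` in `ℚ(q,t)[x, x⁻¹]`.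

We realize `ℚ(q,t)` as `RatFunc (RatFunc ℚ)` (inner variable `q`, outer variable `t`) and
Laurent polynomials in `x` as `LaurentPolynomial (RatFunc (RatFunc ℚ))`,
with `x^n = LaurentPolynomial.T n`.
-/

noncomputable section

/-- The field `ℚ(q,t)`. -/
abbrev K : Type := RatFunc (RatFunc ℚ)

/-- The element `q`. -/
def q : K := RatFunc.C RatFunc.X

/-- The element `t`. -/
def t : K := RatFunc.X

/-- The q-Pochhammer symbol `(a;b)_n = ∏_{k=0}^{n-1} (1 - b^k a)`. -/
def poch (a b : K) (n : ℕ) : K := ∏ k ∈ Finset.range n, (1 - b ^ k * a)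

/-- The `A₁` Macdonald polynomial `P_l(x;t²,q²)` as a Laurent polynomial over `ℚ(q,t)`. -/
def P (l : ℕ) : LaurentPolynomial K :=
  ∑ r ∈ Finset.range (l + 1),
    LaurentPolynomial.C
      (poch (q ^ (2 * l)) (q ^ (-2 : ℤ)) r * poch (t ^ 2) (q ^ 2) r /
        (poch (q ^ (2 * ((l : ℤ) - 1)) * t ^ 2) (q ^ (-2 : ℤ)) r * poch (q ^ 2) (q ^ 2) r))
    * LaurentPolynomial.T ((l : ℤ) - 2 * r)

lemma q_ne : q ≠ 0 := by
  unfold q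
  simp [RatFunc.X_ne_zero]

lemma den_ne (n : ℤ) : 1 - q ^ n * t ^ 2 ≠ 0 := by
  intro h
  have h1 : q ^ n * t ^ 2 = 1 := (sub_eq_zero.mp h).symm
  have hq : q ^ n = RatFunc.C ((RatFunc.X : RatFunc ℚ) ^ n) := by
    unfold q
    rw [map_zpow₀]
  have h2 := congrArg RatFunc.intDegree h1
  have ht : t ≠ 0 := RatFunc.X_ne_zero
  rw [pow_two, RatFunc.intDegree_mul (zpow_ne_zero _ q_ne) (mul_ne_zero ht ht),
    RatFunc.intDegree_mul ht ht, hq, RatFunc.intDegree_C, RatFunc.intDegree_one] at h2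
  unfold t at h2
  rw [RatFunc.intDegree_X] at h2
  omega

lemma qpow_ne (n : ℕ) : 1 - q ^ (n + 1) ≠ 0 := by
  intro h
  have h1 : q ^ (n + 1) = 1 := (sub_eq_zero.mp h).symm
  unfold q at h1
  rw [← map_pow, ← map_one RatFunc.C] at h1
  have h3 : (RatFunc.X : RatFunc ℚ) ^ (n + 1) = 1 := RatFunc.C_injective h1
  rw [← RatFunc.algebraMap_X, ← map_pow, ← map_one (algebraMap (Polynomial ℚ) (RatFunc ℚ))] at h3
  have h4 := RatFunc.algebraMap_injective ℚ h3
  have h5 := congrArg Polynomial.natDegree h4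
  simp at h5

lemma poch_succ (a b : K) (n : ℕ) : poch a b (n + 1) = poch a b n * (1 - b ^ n * a) := by
  unfold poch
  rw [Finset.prod_range_succ]

lemma poch_succ_left (a b : K) (n : ℕ) : poch a b (n + 1) = (1 - a) * poch (b * a) b n := by
  unfold poch
  rw [Finset.prod_range_succ', mul_comm]
  simp [pow_succ, mul_assoc]

/-- The coefficients of `P l`. -/
def cf (l r : ℕ) : K :=
  poch (q ^ (2 * l)) (q ^ (-2 : ℤ)) r * poch (t ^ 2) (q ^ 2) r /
        (poch (q ^ (2 * ((l : ℤ) - 1)) * t ^ 2) (q ^ (-2 : ℤ)) r * poch (q ^ 2) (q ^ 2) r)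

lemma P_eq (l : ℕ) : P l = ∑ r ∈ Finset.range (l + 1),
    LaurentPolynomial.C (cf l r) * LaurentPolynomial.T ((l : ℤ) - 2 * r) := rfl

lemma cf_zero (l : ℕ) : cf l 0 = 1 := by simp [cf, poch]

lemma qinv (r : ℕ) : (q ^ (-2 : ℤ)) ^ r = (q ^ (2 * r))⁻¹ := by
  rw [← zpow_natCast, ← zpow_mul, ← zpow_natCast, ← zpow_neg]
  simp

lemma cf_top (l : ℕ) : cf l (l + 1) = 0 := by
  unfold cf
  rw [poch_succ, qinv, inv_mul_cancel₀ (pow_ne_zero _ q_ne)]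
  simp

lemma pochD_ne (n : ℤ) (r : ℕ) : poch (q ^ n * t ^ 2) (q ^ (-2 : ℤ)) r ≠ 0 := by
  unfold poch
  refine Finset.prod_ne_zero_iff.mpr fun k _ => ?_
  rw [← zpow_natCast, ← zpow_mul, ← mul_assoc, ← zpow_add₀ q_ne]
  exact den_ne _

lemma pochQ_ne (r : ℕ) : poch (q ^ 2) (q ^ 2) r ≠ 0 := by
  unfold poch
  refine Finset.prod_ne_zero_iff.mpr fun k _ => ?_
  rw [← pow_mul, ← pow_add]
  exact qpow_ne (2 * k + 1)

lemma cf_rec (m r : ℕ) : cf (m + 1) (r + 1) + cf (m + 1) r = cf (m + 2) (r + 1) +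
    ((1 - q ^ (2 * (m + 1))) * (1 - q ^ (2 * (((m + 1 : ℕ) : ℤ) - 1)) * t ^ 4) /
      ((1 - q ^ (2 * (m + 1)) * t ^ 2) * (1 - q ^ (2 * (((m + 1 : ℕ) : ℤ) - 1)) * t ^ 2)))
      * cf m r := by
  have hq := q_ne
  have e1 : q ^ (2 * (((m + 1 : ℕ) : ℤ) - 1)) = q ^ (2 * m) := by
    rw [← zpow_natCast]; congr 1; push_cast; ring
  have e2 : q ^ (2 * (((m + 2 : ℕ) : ℤ) - 1)) = q ^ (2 * m) * q ^ 2 := by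
    rw [← pow_add, ← zpow_natCast]; congr 1; push_cast; ring
  have e3 : q ^ (-2 : ℤ) * (q ^ (2 * (m + 2))) = q ^ (2 * (m + 1)) := by
    rw [← zpow_natCast, ← zpow_natCast, ← zpow_add₀ hq]; congr 1; push_cast; ring
  have e4 : q ^ (-2 : ℤ) * (q ^ (2 * (m + 1))) = q ^ (2 * m) := by
    rw [← zpow_natCast, ← zpow_natCast, ← zpow_add₀ hq]; congr 1; push_cast; ring
  have e5 : q ^ (-2 : ℤ) * (q ^ (2 * m) * q ^ 2 * t ^ 2) = q ^ (2 * m) * t ^ 2 := by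
    rw [zpow_neg]
    field_simp
  have e6 : q ^ (-2 : ℤ) * (q ^ (2 * m) * t ^ 2) = q ^ (2 * ((m : ℤ) - 1)) * t ^ 2 := by
    rw [← mul_assoc, ← zpow_natCast, ← zpow_add₀ hq]
    congr 2; push_cast; ring
  have N2 := poch_succ_left (q ^ (2 * (m + 2))) (q ^ (-2 : ℤ)) r
  have N1 := poch_succ_left (q ^ (2 * (m + 1))) (q ^ (-2 : ℤ)) r
  have N0 := poch_succ (q ^ (2 * (m + 1))) (q ^ (-2 : ℤ)) r
  have D2 := poch_succ_left (q ^ (2 * m) * q ^ 2 * t ^ 2) (q ^ (-2 : ℤ)) r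
  have D1 := poch_succ_left (q ^ (2 * m) * t ^ 2) (q ^ (-2 : ℤ)) r
  have D0 := poch_succ (q ^ (2 * m) * t ^ 2) (q ^ (-2 : ℤ)) r
  rw [e3] at N2
  rw [e4] at N1
  rw [e5] at D2
  rw [e6] at D1
  rw [qinv] at N0 D0
  have p1 := pochD_ne (2 * m : ℕ) r
  have p2 := pochD_ne (2 * ((m : ℤ) - 1)) r
  have p3 := pochQ_ne r
  have p4 := pochQ_ne (r + 1)
  have p5 := pochD_ne (2 * m : ℕ) (r + 1)
  have d1 := den_ne (2 * m : ℕ)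
  have d2 := den_ne (2 * (m + 1) : ℕ)
  rw [zpow_natCast] at p1 p5 d1 d2
  unfold cf
  rw [e1, e2, N2, D2]
  rw [N0] at N1
  rw [D0] at D1 p5
  rw [N0, D0, poch_succ (t ^ 2) (q ^ 2) r, poch_succ (q ^ 2) (q ^ 2) r]
  rw [poch_succ (q ^ 2) (q ^ 2) r] at p4
  have e7 : q ^ (2 * (m + 1)) = q ^ (2 * m) * q ^ 2 := by rw [← pow_add]; congr 1
  have e8 : q ^ (2 * (m + 2)) = q ^ (2 * m) * q ^ 4 := by rw [← pow_add]; congr 1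
  have e9 : (q ^ 2) ^ r = q ^ (2 * r) := by rw [← pow_mul]
  have b0 : q ^ (2 * r) ≠ 0 := pow_ne_zero _ hq
  rw [e7] at N1 d2 ⊢
  rw [e8]
  rw [e9] at p4 ⊢
  generalize poch (q ^ (2 * m) * q ^ 2) (q ^ (-2 : ℤ)) r = n1 at *
  generalize poch (q ^ (2 * m)) (q ^ (-2 : ℤ)) r = n0 at *
  generalize poch (q ^ (2 * m) * t ^ 2) (q ^ (-2 : ℤ)) r = x1 at *
  generalize poch (q ^ (2 * ((m : ℤ) - 1)) * t ^ 2) (q ^ (-2 : ℤ)) r = x0 at *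
  generalize poch (t ^ 2) (q ^ 2) r = s at *
  generalize poch (q ^ 2) (q ^ 2) r = w at *
  clear N2 D2 N0 D0 e1 e2 e3 e4 e5 e6 e7 e8 e9
  have f1 := right_ne_zero_of_mul p5
  have f2 := right_ne_zero_of_mul p4
  generalize q ^ (2 * m) = a at *
  generalize q ^ (2 * r) = b at *
  generalize q = u at *
  generalize t = v at *
  have key : (1 - a * u ^ 2) * (1 - a * v ^ 4) / ((1 - a * u ^ 2 * v ^ 2) * (1 - a * v ^ 2)) *
      (n0 * s / (x0 * w)) = (1 - a * v ^ 4) / (1 - a * u ^ 2 * v ^ 2) *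
      (n1 * (1 - b⁻¹ * (a * u ^ 2)) * s / (x1 * (1 - b⁻¹ * (a * v ^ 2)) * w)) := by
    rw [N1, D1]
    field_simp
  rw [key]
  clear key N1 D1 p5 p4 p2 d1
  have f3 : b - a * v ^ 2 ≠ 0 := by
    intro h; apply f1; field_simp; simpa using h
  have f1' : 1 - b⁻¹ * (a * v ^ 2) = (b - a * v ^ 2) / b := by field_simp
  rw [f1']
  clear f1 f1'
  field_simp
  ring

/-- The Pieri rule for `A₁` Macdonald polynomials. -/
theorem macdonald_pieri (l : ℕ) (hl : 1 ≤ l) :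
    (LaurentPolynomial.T 1 + LaurentPolynomial.T (-1)) * P l
      = P (l + 1)
        + LaurentPolynomial.C
            ((1 - q ^ (2 * l)) * (1 - q ^ (2 * ((l : ℤ) - 1)) * t ^ 4) /
              ((1 - q ^ (2 * l) * t ^ 2) * (1 - q ^ (2 * ((l : ℤ) - 1)) * t ^ 2)))
          * P (l - 1) := by
  obtain ⟨m, rfl⟩ : ∃ m, l = m + 1 := ⟨l - 1, by omega⟩
  rw [Nat.add_sub_cancel, P_eq, P_eq, P_eq]
  set A := ((1 - q ^ (2 * (m + 1))) * (1 - q ^ (2 * (((m + 1 : ℕ) : ℤ) - 1)) * t ^ 4) /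
      ((1 - q ^ (2 * (m + 1)) * t ^ 2) * (1 - q ^ (2 * (((m + 1 : ℕ) : ℤ) - 1)) * t ^ 2))) with hA
  have E1 : ∑ r ∈ Finset.range (m + 1), LaurentPolynomial.C (cf m r) *
      LaurentPolynomial.T ((m : ℤ) - 2 * r) = ∑ r ∈ Finset.range (m + 1 + 1),
      LaurentPolynomial.C (cf m r) * LaurentPolynomial.T ((m : ℤ) - 2 * r) := by
    rw [Finset.sum_range_succ _ (m + 1), cf_top]
    simp
  have E2 : ∑ r ∈ Finset.range (m + 1 + 1), LaurentPolynomial.C (cf (m + 1) r) *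
      LaurentPolynomial.T (((m + 1 : ℕ) : ℤ) - 2 * r) = ∑ r ∈ Finset.range (m + 1 + 1 + 1),
      LaurentPolynomial.C (cf (m + 1) r) *
        LaurentPolynomial.T (((m + 1 : ℕ) : ℤ) - 2 * r) := by
    rw [Finset.sum_range_succ _ (m + 1 + 1), cf_top]
    simp
  rw [E1, add_mul]
  nth_rewrite 1 [E2]
  rw [Finset.sum_range_succ' _ (m + 1 + 1), Finset.sum_range_succ' _ (m + 1 + 1), cf_zero, cf_zero,
    mul_add, Finset.mul_sum, Finset.mul_sum, Finset.mul_sum, add_right_comm, add_right_comm (b := _ * _),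
    ← Finset.sum_add_distrib, ← Finset.sum_add_distrib]
  congr 1
  · refine Finset.sum_congr rfl fun r _ => ?_
    have h := congrArg (LaurentPolynomial.C (R := K)) (cf_rec m r)
    rw [← hA, map_add, map_add, map_mul] at h
    have T1 : (LaurentPolynomial.T 1 : LaurentPolynomial K) *
        LaurentPolynomial.T (((m + 1 : ℕ) : ℤ) - 2 * ((r + 1 : ℕ) : ℤ)) =
        LaurentPolynomial.T ((m : ℤ) - 2 * r) := by
      rw [← LaurentPolynomial.T_add]; congr 1; push_cast; ring
    have T2 : (LaurentPolynomial.T (-1) : LaurentPolynomial K) *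
        LaurentPolynomial.T (((m + 1 : ℕ) : ℤ) - 2 * (r : ℤ)) =
        LaurentPolynomial.T ((m : ℤ) - 2 * r) := by
      rw [← LaurentPolynomial.T_add]; congr 1; push_cast; ring
    have T3 : (((m + 1 + 1 : ℕ) : ℤ) - 2 * ((r + 1 : ℕ) : ℤ)) = (m : ℤ) - 2 * r := by
      push_cast; ring
    rw [T3, mul_left_comm, T1, mul_left_comm, T2, ← add_mul, h]
    ring
  · rw [mul_left_comm, ← LaurentPolynomial.T_add]
    congr 2
    push_cast
    ring

end
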